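/- There exist β₀ > 0 and L > 0 such that for all β < β₀, all h ≥ 0, all N ≥ 1, and all k ≥ 1, ν((R_{1,2} − q)^{2k}) ≤ (Lk/N)^k and ν((R⁻_{1,2} − q)^{2k}) ≤ (Lk/N)^k. -/

import Mathlib

open MeasureTheory ProbabilityTheory Finset

noncomputable section

/-- A spin configuration on `N` sites. -/
abbrev Cfg (N : ℕ) := Fin N → Bool

/-- The spin value `±1` of a Boolean. -/
def spin (b : Bool) : ℝ := if b then 1 else -1

/-- Minus the SK Hamiltonian. -/
def negH (N : ℕ) (β h : ℝ) (g : Fin N → Fin N → ℝ) (σ : Cfg N) : ℝ :=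
  (β / Real.sqrt N) *
      ∑ i : Fin N, ∑ j : Fin N, (if i < j then g i j * spin (σ i) * spin (σ j) else 0) +
    h * ∑ i : Fin N, spin (σ i)

/-- Gibbs average `⟨f⟩` of a function of `ι`-indexed replicas. -/
def gibbs (N : ℕ) (β h : ℝ) (g : Fin N → Fin N → ℝ) {ι : Type} [DecidableEq ι] [Fintype ι]
    (f : (ι → Cfg N) → ℝ) : ℝ :=
  (∑ σs : ι → Cfg N, f σs * ∏ l, Real.exp (negH N β h g (σs l))) /
    (∑ σ : Cfg N, Real.exp (negH N β h g σ)) ^ (Fintype.card ι)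

/-- The law of the disorder: i.i.d. standard Gaussians. -/
def gaussN (N : ℕ) : Measure (Fin N → Fin N → ℝ) :=
  Measure.pi fun _ => Measure.pi fun _ => gaussianReal 0 1

/-- `ν(f) = E⟨f⟩`. -/
def nu (N : ℕ) (β h : ℝ) {ι : Type} [DecidableEq ι] [Fintype ι]
    (f : (ι → Cfg N) → ℝ) : ℝ :=
  ∫ g, gibbs N β h g f ∂ gaussN N

/-- `S_l = Σ_i t_i (σ_i^{1(l)} - σ_i^{2(l)})`, replica pairs indexed by `Fin m × Fin 2`. -/
def Sbar (N m : ℕ) (t : Fin N → ℝ) (σs : Fin m × Fin 2 → Cfg N) (l : Fin m) : ℝ :=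
  ∑ i, t i * (spin (σs (l, 0) i) - spin (σs (l, 1) i))

/-- `a(k)`: the `k`-th moment of a standard Gaussian. -/
def gaussMoment (k : ℕ) : ℝ := ∫ x, x ^ k ∂ (gaussianReal 0 1 : Measure ℝ)

/-- The overlap `R_{l,l'}` of two configurations. -/
def overlap (N : ℕ) (σ τ : Cfg N) : ℝ := (∑ i, spin (σ i) * spin (τ i)) / N

/-- The truncated overlap `R⁻_{l,l'} = N^{-1} Σ_{i ≤ N-1} σ_i^l σ_i^{l'}` (here `N = M+1`). -/
def overlapMinus (M : ℕ) (σ τ : Cfg (M + 1)) : ℝ :=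
  (∑ i : Fin M, spin (σ i.castSucc) * spin (τ i.castSucc)) / (M + 1)

/-! ### Gaussian integration by parts -/

lemma integrable_id_gauss : Integrable (fun x : ℝ => x) (gaussianReal 0 1) :=
  (memLp_id_gaussianReal 1).integrable le_rfl

/-- Stein's identity on the line. -/
lemma stein_one {φ φ' : ℝ → ℝ} (hd : ∀ x, HasDerivAt φ (φ' x) x) (hc : Continuous φ')
    {C : ℝ} (hφ : ∀ x, |φ x| ≤ C) (hφ' : ∀ x, |φ' x| ≤ C) :
    ∫ x, x * φ x ∂(gaussianReal 0 1) = ∫ x, φ' x ∂(gaussianReal 0 1) := by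
  have hcφ : Continuous φ := continuous_iff_continuousAt.2 fun x => (hd x).continuousAt
  have hp : ∀ x, HasDerivAt (gaussianPDFReal 0 1) (-(x * gaussianPDFReal 0 1 x)) x := by
    intro x
    have h1 : HasDerivAt (fun x : ℝ => (Real.sqrt (2 * Real.pi * (1 : NNReal)))⁻¹ *
        Real.exp (-(x - 0) ^ 2 / (2 * (1 : NNReal)))) _ x :=
      ((((((hasDerivAt_id x).sub_const 0).pow 2).neg).div_const _).exp).const_mul _
    rw [gaussianPDFReal_def]
    refine h1.congr_deriv ?_
    simp
    ring
  have hi : Integrable (gaussianPDFReal 0 1) := integrable_gaussianPDFReal 0 1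
  have hxi : Integrable (fun x => x * gaussianPDFReal 0 1 x) := by
    have := integrable_id_gauss
    rw [gaussianReal_of_var_ne_zero _ one_ne_zero,
      integrable_withDensity_iff_integrable_smul' (measurable_gaussianPDF 0 1)
        (by simp [gaussianPDF_lt_top])] at this
    simpa [toReal_gaussianPDF, mul_comm] using this
  rw [integral_gaussianReal_eq_integral_smul one_ne_zero,
    integral_gaussianReal_eq_integral_smul one_ne_zero]
  have key := integral_mul_deriv_eq_deriv_mul_of_integrable (u := φ) (u' := φ')
    (v := gaussianPDFReal 0 1) (v' := fun x => -(x * gaussianPDFReal 0 1 x))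
    (fun x _ => hd x) (fun x _ => hp x)
    (hxi.neg.bdd_mul (c := C) hcφ.aestronglyMeasurable (.of_forall hφ))
    (hi.bdd_mul (c := C) hc.aestronglyMeasurable (.of_forall hφ'))
    (hi.bdd_mul (c := C) hcφ.aestronglyMeasurable (.of_forall hφ))
  simp only [smul_eq_mul]
  rw [show (fun x => gaussianPDFReal 0 1 x * φ' x) = fun x => φ' x * gaussianPDFReal 0 1 x from
    funext fun x => mul_comm _ _, ← neg_eq_iff_eq_neg.2 key, ← integral_neg]
  congr 1
  ext x
  ring

section GaussianVector

variable {I : Type} [Fintype I]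

/-- The standard Gaussian vector indexed by `I`. -/
def stdGauss (I : Type) [Fintype I] : Measure (I → ℝ) := Measure.pi fun _ => gaussianReal 0 1

instance : IsProbabilityMeasure (stdGauss I) := by unfold stdGauss; infer_instance

lemma measurePreserving_update_stdGauss [DecidableEq I] (a : I) :
    MeasurePreserving (fun p : ℝ × (I → ℝ) => Function.update p.2 a p.1)
      ((gaussianReal 0 1).prod (stdGauss I)) (stdGauss I) := by
  have hm : Measurable (fun p : ℝ × (I → ℝ) => Function.update p.2 a p.1) := by
    refine measurable_pi_lambda _ fun b => ?_
    by_cases h : b = a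
    · subst h; simpa using measurable_fst
    · simp only [Function.update_of_ne h]; fun_prop
  refine ⟨hm, ?_⟩
  symm
  refine Measure.pi_eq fun s hs => ?_
  rw [Measure.map_apply hm (.univ_pi hs)]
  have : (fun p : ℝ × (I → ℝ) => Function.update p.2 a p.1) ⁻¹' Set.univ.pi s =
      s a ×ˢ Set.univ.pi (Function.update s a Set.univ) := by
    ext p
    simp only [Set.mem_preimage, Set.mem_pi, Set.mem_univ, true_implies, Set.mem_prod]
    constructor
    · intro h
      refine ⟨by simpa using h a, fun b => ?_⟩
      by_cases hb : b = a
      · subst hb; simp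
      · simpa [hb] using h b
    · rintro ⟨h1, h2⟩ b
      by_cases hb : b = a
      · subst hb; simpa using h1
      · simpa [hb] using h2 b
  rw [this, Measure.prod_prod, stdGauss, Measure.pi_pi,
    ← Finset.mul_prod_erase _ (fun i => (gaussianReal 0 1) (s i)) (mem_univ a),
    ← Finset.mul_prod_erase _ _ (mem_univ a)]
  simp only [Function.update_self, measure_univ, one_mul]
  congr 1
  refine Finset.prod_congr rfl fun b hb => ?_
  rw [Function.update_of_ne (Finset.ne_of_mem_erase hb)]

lemma integrable_coord_stdGauss (a : I) : Integrable (fun x : I → ℝ => x a) (stdGauss I) :=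
  (measurePreserving_eval (fun _ : I => (gaussianReal 0 1)) a).integrable_comp_of_integrable
    integrable_id_gauss

/-- Gaussian integration by parts in one coordinate of a Gaussian vector. -/
lemma stein_coord [DecidableEq I] (a : I) {φ φ' : (I → ℝ) → ℝ}
    (hd : ∀ x, HasDerivAt (fun s => φ (Function.update x a s)) (φ' x) (x a))
    (hφc : Continuous φ) (hc : Continuous φ')
    {C : ℝ} (hφ : ∀ x, |φ x| ≤ C) (hφ' : ∀ x, |φ' x| ≤ C) :
    ∫ x, x a * φ x ∂(stdGauss I) = ∫ x, φ' x ∂(stdGauss I) := by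
  have hmp := measurePreserving_update_stdGauss a
  have i1 : Integrable (fun x : I → ℝ => x a * φ x) (stdGauss I) :=
    (integrable_coord_stdGauss a).mul_bdd (c := C) hφc.aestronglyMeasurable (.of_forall hφ)
  have i2 : Integrable φ' (stdGauss I) :=
    .of_bound hc.aestronglyMeasurable C (.of_forall hφ')
  rw [← hmp.map_eq, integral_map hmp.aemeasurable (by rw [hmp.map_eq]; exact i1.1),
    integral_map hmp.aemeasurable (by rw [hmp.map_eq]; exact i2.1)]
  refine (integral_prod_symm _ (hmp.integrable_comp_of_integrable i1)).trans
    (Eq.trans ?_ (integral_prod_symm _ (hmp.integrable_comp_of_integrable i2)).symm)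
  congr 1
  ext x
  simp only [Function.comp_apply, Function.update_self]
  refine stein_one (φ := fun s => φ (Function.update x a s))
    (φ' := fun s => φ' (Function.update x a s)) (C := C) (fun s => ?_) ?_
    (fun s => hφ _) (fun s => hφ' _)
  · simpa using hd (Function.update x a s)
  · exact hc.comp (continuous_const.update a continuous_id)

end GaussianVector

/-! ### Gibbs weights and averages over pairs of replicas -/

section Softmax

variable {S : Type} [Fintype S]

/-- The Gibbs weight of `σ` for the energies `u`. -/
def softmax (u : S → ℝ) (σ : S) : ℝ := Real.exp (u σ) / ∑ τ, Real.exp (u τ)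

/-- The average of `f` over two independent replicas with energies `u`. -/
def pairAvg (u : S → ℝ) (f : S → S → ℝ) : ℝ := ∑ σ, ∑ τ, softmax u σ * softmax u τ * f σ τ

lemma softmax_nonneg (u : S → ℝ) (σ : S) : 0 ≤ softmax u σ := by
  unfold softmax; positivity

lemma sum_exp_pos [Nonempty S] (u : S → ℝ) : 0 < ∑ τ, Real.exp (u τ) :=
  Finset.sum_pos (fun _ _ => Real.exp_pos _) univ_nonempty

lemma sum_softmax [Nonempty S] (u : S → ℝ) : ∑ σ, softmax u σ = 1 := by
  simp only [softmax, ← Finset.sum_div]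
  exact div_self (sum_exp_pos u).ne'

lemma pairAvg_add (u : S → ℝ) (f g : S → S → ℝ) :
    pairAvg u (fun σ τ => f σ τ + g σ τ) = pairAvg u f + pairAvg u g := by
  simp only [pairAvg, mul_add, Finset.sum_add_distrib]

lemma pairAvg_const_mul (u : S → ℝ) (c : ℝ) (f : S → S → ℝ) :
    pairAvg u (fun σ τ => c * f σ τ) = c * pairAvg u f := by
  simp only [pairAvg, Finset.mul_sum]
  exact Finset.sum_congr rfl fun _ _ => Finset.sum_congr rfl fun _ _ => by ring

lemma pairAvg_sum {I : Type} [Fintype I] (u : S → ℝ) (f : I → S → S → ℝ) :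
    pairAvg u (fun σ τ => ∑ a, f a σ τ) = ∑ a, pairAvg u (f a) := by
  simp only [pairAvg, Finset.mul_sum]
  rw [Finset.sum_comm (s := (univ : Finset I))]
  refine Finset.sum_congr rfl fun σ _ => ?_
  rw [Finset.sum_comm]

lemma pairAvg_mono {u : S → ℝ} {f g : S → S → ℝ} (h : ∀ σ τ, f σ τ ≤ g σ τ) :
    pairAvg u f ≤ pairAvg u g :=
  Finset.sum_le_sum fun σ _ => Finset.sum_le_sum fun τ _ =>
    mul_le_mul_of_nonneg_left (h σ τ) (mul_nonneg (softmax_nonneg _ _) (softmax_nonneg _ _))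

lemma pairAvg_const [Nonempty S] (u : S → ℝ) (c : ℝ) : pairAvg u (fun _ _ => c) = c := by
  simp only [pairAvg, ← Finset.sum_mul, ← Finset.mul_sum, sum_softmax, mul_one, one_mul]

lemma abs_pairAvg_le [Nonempty S] {u : S → ℝ} {f : S → S → ℝ} {C : ℝ}
    (h : ∀ σ τ, |f σ τ| ≤ C) : |pairAvg u f| ≤ C := by
  rw [abs_le]
  constructor
  · rw [← pairAvg_const u (-C)]
    exact pairAvg_mono fun σ τ => (abs_le.1 (h σ τ)).1
  · rw [← pairAvg_const u C]
    exact pairAvg_mono fun σ τ => (abs_le.1 (h σ τ)).2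

lemma continuous_softmax [Nonempty S] {X : Type} [TopologicalSpace X] {u : X → S → ℝ}
    (hu : ∀ σ, Continuous fun x => u x σ) (σ : S) : Continuous fun x => softmax (u x) σ := by
  unfold softmax
  exact ((hu σ).rexp).div (continuous_finsetSum _ fun τ _ => (hu τ).rexp)
    fun x => (sum_exp_pos _).ne'

lemma continuous_pairAvg [Nonempty S] {X : Type} [TopologicalSpace X] {u : X → S → ℝ}
    {f : X → S → S → ℝ} (hu : ∀ σ, Continuous fun x => u x σ)
    (hf : ∀ σ τ, Continuous fun x => f x σ τ) : Continuous fun x => pairAvg (u x) (f x) :=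
  continuous_finsetSum _ fun σ _ => continuous_finsetSum _ fun τ _ =>
    ((continuous_softmax hu σ).mul (continuous_softmax hu τ)).mul (hf σ τ)

lemma hasDerivAt_softmax [Nonempty S] {u : ℝ → S → ℝ} {u' : S → ℝ} {t : ℝ}
    (hu : ∀ σ, HasDerivAt (fun t => u t σ) (u' σ) t) (σ : S) :
    HasDerivAt (fun t => softmax (u t) σ)
      (softmax (u t) σ * (u' σ - ∑ τ, softmax (u t) τ * u' τ)) t := by
  unfold softmax
  have h := (hu σ).exp.div (HasDerivAt.fun_sum fun τ (_ : τ ∈ univ) => (hu τ).exp)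
    (sum_exp_pos (u t)).ne'
  refine h.congr_deriv ?_
  have hz := (sum_exp_pos (u t)).ne'
  simp only [div_mul_eq_mul_div, ← Finset.sum_div]
  field_simp

lemma hasDerivAt_pairAvg [Nonempty S] {u : ℝ → S → ℝ} {u' : S → ℝ} {f : ℝ → S → S → ℝ}
    {f' : S → S → ℝ} {t : ℝ} (hu : ∀ σ, HasDerivAt (fun t => u t σ) (u' σ) t)
    (hf : ∀ σ τ, HasDerivAt (fun t => f t σ τ) (f' σ τ) t) :
    HasDerivAt (fun t => pairAvg (u t) (f t))
      (pairAvg (u t) fun σ τ => f' σ τ +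
        f t σ τ * (u' σ + u' τ - 2 * ∑ ρ, softmax (u t) ρ * u' ρ)) t := by
  unfold pairAvg
  refine HasDerivAt.fun_sum fun σ _ => HasDerivAt.fun_sum fun τ _ => ?_
  refine (((hasDerivAt_softmax hu σ).mul (hasDerivAt_softmax hu τ)).mul (hf σ τ)).congr_deriv ?_
  simp only [Pi.mul_apply]
  ring

/-- Chebyshev's association inequality for the Gibbs average. -/
lemma pairAvg_exp_mul_le [Nonempty S] (u : S → ℝ) (Y : S → S → ℝ) {l : ℝ} (hl : 0 ≤ l) :
    pairAvg u (fun σ τ => Real.exp (l * Y σ τ)) * pairAvg u Y ≤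
      pairAvg u fun σ τ => Y σ τ * Real.exp (l * Y σ τ) := by
  set y := pairAvg u Y with hy
  have h0 : pairAvg u (fun σ τ => y * Real.exp (l * Y σ τ) +
      (Real.exp (l * y) * Y σ τ + -(Real.exp (l * y) * y))) ≤
      pairAvg u fun σ τ => Y σ τ * Real.exp (l * Y σ τ) := by
    refine pairAvg_mono fun σ τ => ?_
    rcases le_total y (Y σ τ) with h | h
    · have := Real.exp_le_exp.2 (mul_le_mul_of_nonneg_left h hl)
      nlinarith
    · have := Real.exp_le_exp.2 (mul_le_mul_of_nonneg_left h hl)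
      nlinarith
  rw [pairAvg_add, pairAvg_add, pairAvg_const_mul, pairAvg_const_mul, pairAvg_const, ← hy] at h0
  linarith

/-- The second-order term of the interpolation, after summation over the disorder. -/
lemma sum_pairAvg_second_order_le [Nonempty S] {I : Type} [Fintype I] (u : S → ℝ)
    (A : I → S → ℝ) (c : I → ℝ) (Y : S → S → ℝ) (hY : ∀ σ τ, 0 ≤ Y σ τ) {κ d l : ℝ}
    (hκ : 0 ≤ κ) (hl : 0 ≤ l)
    (hc : ∀ σ τ, ∑ a, c a * (A a σ * A a τ) = κ * Y σ τ + d) :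
    ∑ a, c a * pairAvg u (fun σ τ => Real.exp (l * Y σ τ) *
        (2 * A a σ * A a τ - 4 * (∑ ρ, softmax u ρ * A a ρ) * (A a σ + A a τ) +
          6 * (∑ ρ, softmax u ρ * A a ρ) ^ 2)) ≤
      8 * κ * pairAvg u fun σ τ => Y σ τ * Real.exp (l * Y σ τ) := by
  have hL : ∀ σ, ∑ a, c a * ((∑ ρ, softmax u ρ * A a ρ) * A a σ) =
      κ * (∑ ρ, softmax u ρ * Y ρ σ) + d := by
    intro σ
    calc ∑ a, c a * ((∑ ρ, softmax u ρ * A a ρ) * A a σ)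
        = ∑ ρ, softmax u ρ * ∑ a, c a * (A a ρ * A a σ) := by
          simp only [Finset.mul_sum, Finset.sum_mul]
          rw [Finset.sum_comm]
          exact Finset.sum_congr rfl fun _ _ => Finset.sum_congr rfl fun _ _ => by ring
      _ = _ := by
          simp only [hc, mul_add, Finset.sum_add_distrib, ← Finset.sum_mul, sum_softmax,
            Finset.mul_sum, one_mul]
          congr 1
          exact Finset.sum_congr rfl fun _ _ => by ring
  have hLL : ∑ a, c a * (∑ ρ, softmax u ρ * A a ρ) ^ 2 = κ * pairAvg u Y + d := by
    calc ∑ a, c a * (∑ ρ, softmax u ρ * A a ρ) ^ 2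
        = ∑ σ, softmax u σ * ∑ a, c a * ((∑ ρ, softmax u ρ * A a ρ) * A a σ) := by
          simp only [Finset.mul_sum (s := (univ : Finset I))]
          rw [Finset.sum_comm]
          refine Finset.sum_congr rfl fun a _ => ?_
          rw [sq, ← mul_assoc, Finset.mul_sum]
          exact Finset.sum_congr rfl fun _ _ => by ring
      _ = _ := by
          simp only [hL, mul_add, Finset.sum_add_distrib, ← Finset.sum_mul, sum_softmax, one_mul]
          congr 1
          rw [pairAvg, Finset.sum_comm, Finset.mul_sum]
          refine Finset.sum_congr rfl fun _ _ => ?_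
          rw [Finset.mul_sum, Finset.mul_sum, Finset.mul_sum]
          exact Finset.sum_congr rfl fun _ _ => by ring
  have hrw : ∑ a, c a * pairAvg u (fun σ τ => Real.exp (l * Y σ τ) *
        (2 * A a σ * A a τ - 4 * (∑ ρ, softmax u ρ * A a ρ) * (A a σ + A a τ) +
          6 * (∑ ρ, softmax u ρ * A a ρ) ^ 2)) =
      pairAvg u fun σ τ => Real.exp (l * Y σ τ) *
        (2 * (κ * Y σ τ + d) - 4 * (κ * (∑ ρ, softmax u ρ * Y ρ σ) + d)
          - 4 * (κ * (∑ ρ, softmax u ρ * Y ρ τ) + d) + 6 * (κ * pairAvg u Y + d)) := by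
    generalize pairAvg u Y = y at hLL
    simp only [← pairAvg_const_mul, ← pairAvg_sum]
    congr 1
    ext σ τ
    rw [← hc, ← hL, ← hL, ← hLL]
    simp only [Finset.mul_sum (s := (univ : Finset I)), ← Finset.sum_add_distrib,
      ← Finset.sum_sub_distrib]
    exact Finset.sum_congr rfl fun _ _ => by ring
  rw [hrw]
  have hmono : pairAvg u (fun σ τ => Real.exp (l * Y σ τ) *
        (2 * (κ * Y σ τ + d) - 4 * (κ * (∑ ρ, softmax u ρ * Y ρ σ) + d)
          - 4 * (κ * (∑ ρ, softmax u ρ * Y ρ τ) + d) + 6 * (κ * pairAvg u Y + d))) ≤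
      pairAvg u fun σ τ => 2 * κ * (Y σ τ * Real.exp (l * Y σ τ)) +
        6 * κ * pairAvg u Y * Real.exp (l * Y σ τ) := by
    refine pairAvg_mono fun σ τ => ?_
    have h1 : ∀ σ, 0 ≤ κ * (∑ ρ, softmax u ρ * Y ρ σ) := fun σ =>
      mul_nonneg hκ (Finset.sum_nonneg fun ρ _ => mul_nonneg (softmax_nonneg _ _) (hY _ _))
    have h2 := mul_nonneg (Real.exp_pos (l * Y σ τ)).le (h1 σ)
    have h3 := mul_nonneg (Real.exp_pos (l * Y σ τ)).le (h1 τ)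
    nlinarith
  refine hmono.trans ?_
  rw [pairAvg_add, pairAvg_const_mul, pairAvg_const_mul]
  have := mul_le_mul_of_nonneg_left (pairAvg_exp_mul_le u Y hl) hκ
  nlinarith

lemma abs_le_sum_sum_abs (f : S → S → ℝ) (σ τ : S) : |f σ τ| ≤ ∑ σ, ∑ τ, |f σ τ| :=
  (Finset.single_le_sum (f := fun τ => |f σ τ|) (fun _ _ => abs_nonneg _) (mem_univ τ)).trans
    (Finset.single_le_sum (f := fun σ => ∑ τ, |f σ τ|)
      (fun _ _ => Finset.sum_nonneg fun _ _ => abs_nonneg _) (mem_univ σ))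

end Softmax

/-! ### Interpolation -/

section Interpolation

variable {S I : Type} [Fintype I]

/-- The energy with disorder `x`, weights `w`, interactions `A` and external field `B`. -/
def disorderEnergy (A : I → S → ℝ) (B : S → ℝ) (w x : I → ℝ) (σ : S) : ℝ :=
  ∑ a, w a * x a * A a σ + B σ

lemma continuous_disorderEnergy (A : I → S → ℝ) (B : S → ℝ) (w : I → ℝ) (σ : S) :
    Continuous fun x => disorderEnergy A B w x σ := by
  unfold disorderEnergy; fun_prop

lemma hasDerivAt_disorderEnergy (A : I → S → ℝ) (B : S → ℝ) {w : ℝ → I → ℝ} {w' : I → ℝ} {t : ℝ}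
    (hw : ∀ a, HasDerivAt (fun t => w t a) (w' a) t) (x : I → ℝ) (σ : S) :
    HasDerivAt (fun t => disorderEnergy A B (w t) x σ) (∑ a, w' a * x a * A a σ) t :=
  (HasDerivAt.fun_sum fun a _ => ((hw a).mul_const _).mul_const _).add_const _

lemma hasDerivAt_disorderEnergy_update [DecidableEq I] (A : I → S → ℝ) (B : S → ℝ) (w : I → ℝ)
    (x : I → ℝ) (a : I) (σ : S) (t : ℝ) :
    HasDerivAt (fun s => disorderEnergy A B w (Function.update x a s) σ) (w a * A a σ) t := by
  have h : (fun s => disorderEnergy A B w (Function.update x a s) σ) = fun s =>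
      w a * s * A a σ + (∑ b ∈ univ.erase a, w b * x b * A b σ + B σ) := by
    ext s
    rw [disorderEnergy, ← Finset.add_sum_erase _ _ (mem_univ a), Function.update_self, add_assoc]
    congr 2
    refine Finset.sum_congr rfl fun b hb => ?_
    rw [Function.update_of_ne (Finset.ne_of_mem_erase hb)]
  rw [h]
  simpa using (((hasDerivAt_id t).const_mul (w a)).mul_const (A a σ)).add_const
    (∑ b ∈ univ.erase a, w b * x b * A b σ + B σ)

variable [Fintype S] [Nonempty S]

lemma abs_sum_softmax_mul_le (u : S → ℝ) {f : S → ℝ} {C : ℝ} (hf : ∀ σ, |f σ| ≤ C) :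
    |∑ ρ, softmax u ρ * f ρ| ≤ C := by
  calc |∑ ρ, softmax u ρ * f ρ| ≤ ∑ ρ, softmax u ρ * C := by
        refine (Finset.abs_sum_le_sum_abs _ _).trans (Finset.sum_le_sum fun ρ _ => ?_)
        rw [abs_mul, abs_of_nonneg (softmax_nonneg u ρ)]
        exact mul_le_mul_of_nonneg_left (hf ρ) (softmax_nonneg u ρ)
    _ = C := by rw [← Finset.sum_mul, sum_softmax, one_mul]

lemma abs_second_order_le {x y m : ℝ} (hx : |x| ≤ 1) (hy : |y| ≤ 1) (hm : |m| ≤ 1) :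
    |2 * x * y - 4 * m * (x + y) + 6 * m ^ 2| ≤ 16 := by
  have e1 : |x * y| ≤ 1 := by
    rw [abs_mul]; exact mul_le_one₀ hx (abs_nonneg _) hy
  have e2 : |m * x| ≤ 1 := by
    rw [abs_mul]; exact mul_le_one₀ hm (abs_nonneg _) hx
  have e3 : |m * y| ≤ 1 := by
    rw [abs_mul]; exact mul_le_one₀ hm (abs_nonneg _) hy
  have e4 : |m ^ 2| ≤ 1 := by
    rw [abs_pow]; exact pow_le_one₀ (abs_nonneg _) hm
  rw [abs_le] at *
  constructor <;> nlinarith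

lemma integrable_pairAvg (A : I → S → ℝ) (B : S → ℝ) (w : I → ℝ) (f : S → S → ℝ) :
    Integrable (fun x => pairAvg (disorderEnergy A B w x) f) (stdGauss I) := by
  have hc : Continuous fun x => pairAvg (disorderEnergy A B w x) f :=
    continuous_pairAvg (f := fun _ => f) (continuous_disorderEnergy A B w) fun _ _ =>
      continuous_const
  have hb : ∀ x, |pairAvg (disorderEnergy A B w x) f| ≤ ∑ σ, ∑ τ, |f σ τ| := fun x =>
    abs_pairAvg_le fun σ τ => abs_le_sum_sum_abs f σ τ
  exact .of_bound hc.aestronglyMeasurable _ (.of_forall hb)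

/-- Gaussian integration by parts for the Gibbs average of a two-replica function. -/
lemma integral_coord_mul_pairAvg (A : I → S → ℝ) (hA : ∀ a σ, A a σ ^ 2 = 1) (B : S → ℝ)
    (w : I → ℝ) (f : S → S → ℝ) (a : I) :
    ∫ x, x a * pairAvg (disorderEnergy A B w x) (fun σ τ => f σ τ *
        (A a σ + A a τ - 2 * ∑ ρ, softmax (disorderEnergy A B w x) ρ * A a ρ)) ∂stdGauss I =
      ∫ x, w a * pairAvg (disorderEnergy A B w x) (fun σ τ => f σ τ *
        (2 * A a σ * A a τ -
          4 * (∑ ρ, softmax (disorderEnergy A B w x) ρ * A a ρ) * (A a σ + A a τ) +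
          6 * (∑ ρ, softmax (disorderEnergy A B w x) ρ * A a ρ) ^ 2)) ∂stdGauss I := by
  classical
  have hA1 : ∀ σ, |A a σ| ≤ 1 := fun σ => by
    rw [← sq_le_one_iff_abs_le_one, hA]
  have hf := abs_le_sum_sum_abs f
  set C := ∑ σ, ∑ τ, |f σ τ|
  have hC : 0 ≤ C := Finset.sum_nonneg fun _ _ => Finset.sum_nonneg fun _ _ => abs_nonneg _
  have hu := continuous_disorderEnergy A B w
  have hm : Continuous fun x => ∑ ρ, softmax (disorderEnergy A B w x) ρ * A a ρ :=
    continuous_finsetSum _ fun ρ _ => (continuous_softmax hu ρ).mul_const _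
  refine stein_coord a (C := max (C * 4) (|w a| * (C * 16))) (fun x => ?_) ?_ ?_
    (fun x => ?_) (fun x => ?_)
  · have h1 : ∀ ρ, HasDerivAt (fun s => disorderEnergy A B w (Function.update x a s) ρ)
        (w a * A a ρ) (x a) := fun ρ => hasDerivAt_disorderEnergy_update A B w x a ρ (x a)
    have h2 := HasDerivAt.fun_sum fun ρ (_ : ρ ∈ univ) =>
      (hasDerivAt_softmax h1 ρ).mul_const (A a ρ)
    have h3 := hasDerivAt_pairAvg h1 fun σ τ =>
      ((h2.const_mul 2).const_sub (A a σ + A a τ)).const_mul (f σ τ)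
    refine h3.congr_deriv ?_
    rw [Function.update_eq_self, ← pairAvg_const_mul]
    congr 1
    ext σ τ
    set p := softmax (disorderEnergy A B w x)
    have e1 : ∑ ρ, p ρ * (w a * A a ρ) = w a * ∑ ρ, p ρ * A a ρ := by
      rw [Finset.mul_sum]; exact Finset.sum_congr rfl fun _ _ => by ring
    have e2 : ∑ ρ, p ρ * (w a * A a ρ - w a * ∑ ρ, p ρ * A a ρ) * A a ρ =
        w a * (1 - (∑ ρ, p ρ * A a ρ) ^ 2) := by
      have : ∀ ρ, p ρ * (w a * A a ρ - w a * ∑ ρ, p ρ * A a ρ) * A a ρ =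
          w a * (p ρ - (p ρ * A a ρ) * ∑ ρ, p ρ * A a ρ) := fun ρ => by
        linear_combination (p ρ * w a) * hA a ρ
      simp only [this]
      rw [← Finset.mul_sum, Finset.sum_sub_distrib, ← Finset.sum_mul, sum_softmax, sq]
    rw [e1, e2]
    linear_combination (f σ τ * w a) * (hA a σ + hA a τ)
  · exact continuous_pairAvg hu fun σ τ => by fun_prop
  · exact (continuous_pairAvg hu fun σ τ => by fun_prop).const_mul _
  · refine le_max_of_le_left (abs_pairAvg_le fun σ τ => ?_)
    rw [abs_mul]
    refine mul_le_mul (hf σ τ) ?_ (abs_nonneg _) hC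
    have := abs_le.1 (abs_sum_softmax_mul_le (disorderEnergy A B w x) hA1)
    have h1 := abs_le.1 (hA1 σ)
    have h2 := abs_le.1 (hA1 τ)
    exact abs_le.2 ⟨by linarith, by linarith⟩
  · refine le_max_of_le_right ?_
    rw [abs_mul]
    refine mul_le_mul_of_nonneg_left (abs_pairAvg_le fun σ τ => ?_) (abs_nonneg _)
    rw [abs_mul]
    refine mul_le_mul (hf σ τ) ?_ (abs_nonneg _) hC
    exact abs_second_order_le (hA1 σ) (hA1 τ) (abs_sum_softmax_mul_le _ hA1)

/-- Along an interpolation of Gaussian energies whose covariance derivative is `κ Y` up to a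
constant, exponential moments of `Y` are controlled by decreasing the exponent at rate `8 κ`. -/
theorem integral_pairAvg_exp_antitone (A : I → S → ℝ) (hA : ∀ a σ, A a σ ^ 2 = 1) (B : S → ℝ)
    (Y : S → S → ℝ) (hY : ∀ σ τ, 0 ≤ Y σ τ) {w w' : ℝ → I → ℝ} {l κ d : ℝ → ℝ} {K T : ℝ}
    (hT : 0 ≤ T)
    (hw : ∀ t a, HasDerivAt (fun t => w t a) (w' t a) t) (hw' : ∀ t a, |w' t a| ≤ K)
    (hl : ∀ t, HasDerivAt l (-(8 * κ t)) t) (hl0 : ∀ t, 0 ≤ l t) (hlK : ∀ t, l t ≤ K)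
    (hκ : ∀ t ∈ Set.Icc 0 T, 0 ≤ κ t) (hκK : ∀ t, |8 * κ t| ≤ K)
    (hc : ∀ t σ τ, ∑ a, w' t a * w t a * (A a σ * A a τ) = κ t * Y σ τ + d t) :
    ∫ x, pairAvg (disorderEnergy A B (w T) x) (fun σ τ => Real.exp (l T * Y σ τ)) ∂stdGauss I ≤
      ∫ x, pairAvg (disorderEnergy A B (w 0) x) (fun σ τ => Real.exp (l 0 * Y σ τ))
        ∂stdGauss I := by
  have hK : 0 ≤ K := (abs_nonneg _).trans (hκK 0)
  have hA1 : ∀ a σ, |A a σ| ≤ 1 := fun a σ => by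
    rw [← sq_le_one_iff_abs_le_one, hA]
  set C := ∑ σ, ∑ τ, |Y σ τ|
  have hC : 0 ≤ C := Finset.sum_nonneg fun _ _ => Finset.sum_nonneg fun _ _ => abs_nonneg _
  have hYC : ∀ σ τ, Y σ τ ≤ C := fun σ τ => (le_abs_self _).trans (abs_le_sum_sum_abs Y σ τ)
  have hexp : ∀ t σ τ, |Real.exp (l t * Y σ τ)| ≤ Real.exp (K * C) := fun t σ τ => by
    rw [abs_of_pos (Real.exp_pos _)]
    exact Real.exp_le_exp.2 (mul_le_mul (hlK t) (hYC σ τ) (hY _ _) hK)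
  set D : ℝ → I → (I → ℝ) → ℝ := fun t a x =>
    pairAvg (disorderEnergy A B (w t) x) (fun σ τ => Real.exp (l t * Y σ τ) *
        (A a σ + A a τ - 2 * ∑ ρ, softmax (disorderEnergy A B (w t) x) ρ * A a ρ)) with hD
  set E : ℝ → I → (I → ℝ) → ℝ := fun t a x =>
    pairAvg (disorderEnergy A B (w t) x) (fun σ τ => Real.exp (l t * Y σ τ) *
        (2 * A a σ * A a τ -
          4 * (∑ ρ, softmax (disorderEnergy A B (w t) x) ρ * A a ρ) * (A a σ + A a τ) +
          6 * (∑ ρ, softmax (disorderEnergy A B (w t) x) ρ * A a ρ) ^ 2)) with hE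
  set P : ℝ → (I → ℝ) → ℝ := fun t x =>
    pairAvg (disorderEnergy A B (w t) x) (fun σ τ => Y σ τ * Real.exp (l t * Y σ τ)) with hP
  set F : ℝ → (I → ℝ) → ℝ := fun t x =>
    pairAvg (disorderEnergy A B (w t) x) (fun σ τ => Real.exp (l t * Y σ τ)) with hF
  set F' : ℝ → (I → ℝ) → ℝ := fun t x =>
    -(8 * κ t) * P t x + ∑ a, w' t a * (x a * D t a x) with hF'
  have hm : ∀ t a, Continuous fun x => ∑ ρ, softmax (disorderEnergy A B (w t) x) ρ * A a ρ :=
    fun t a => continuous_finsetSum _ fun ρ _ =>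
      (continuous_softmax (continuous_disorderEnergy A B (w t)) ρ).mul_const _
  have cF : ∀ t, Continuous (F t) := fun t =>
    continuous_pairAvg (continuous_disorderEnergy A B (w t)) fun σ τ => continuous_const
  have cP : ∀ t, Continuous (P t) := fun t =>
    continuous_pairAvg (continuous_disorderEnergy A B (w t)) fun σ τ => continuous_const
  have cD : ∀ t a, Continuous (D t a) := fun t a =>
    continuous_pairAvg (continuous_disorderEnergy A B (w t)) fun σ τ => by
      have := hm t a
      fun_prop
  have cE : ∀ t a, Continuous (E t a) := fun t a =>
    continuous_pairAvg (continuous_disorderEnergy A B (w t)) fun σ τ => by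
      have := hm t a
      fun_prop
  have bD : ∀ t a x, |D t a x| ≤ Real.exp (K * C) * 4 := fun t a x => by
    refine abs_pairAvg_le fun σ τ => ?_
    rw [abs_mul]
    refine mul_le_mul (hexp t σ τ) ?_ (abs_nonneg _) (Real.exp_pos _).le
    have := abs_le.1 (abs_sum_softmax_mul_le (disorderEnergy A B (w t) x) (hA1 a))
    have h1 := abs_le.1 (hA1 a σ)
    have h2 := abs_le.1 (hA1 a τ)
    exact abs_le.2 ⟨by linarith, by linarith⟩
  have bP : ∀ t x, |P t x| ≤ C * Real.exp (K * C) := fun t x => by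
    refine abs_pairAvg_le fun σ τ => ?_
    rw [abs_mul, abs_of_nonneg (hY σ τ)]
    exact mul_le_mul (hYC σ τ) (hexp t σ τ) (abs_nonneg _) hC
  have iF : ∀ t, Integrable (F t) (stdGauss I) := fun t => integrable_pairAvg A B (w t) _
  have iP : ∀ t, Integrable (P t) (stdGauss I) := fun t => integrable_pairAvg A B (w t) _
  have ixD : ∀ t a, Integrable (fun x => x a * D t a x) (stdGauss I) := fun t a =>
    (integrable_coord_stdGauss a).mul_bdd (cD t a).aestronglyMeasurable (.of_forall (bD t a))
  have iE : ∀ t a, Integrable (E t a) (stdGauss I) := by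
    intro t a
    refine .of_bound (cE t a).aestronglyMeasurable (Real.exp (K * C) * 16) (.of_forall fun x => ?_)
    refine abs_pairAvg_le fun σ τ => ?_
    rw [abs_mul]
    exact mul_le_mul (hexp t σ τ)
      (abs_second_order_le (hA1 a σ) (hA1 a τ) (abs_sum_softmax_mul_le _ (hA1 a)))
      (abs_nonneg _) (Real.exp_pos _).le
  have hder : ∀ t x, HasDerivAt (fun t => F t x) (F' t x) t := by
    intro t x
    have h1 := hasDerivAt_pairAvg (fun σ => hasDerivAt_disorderEnergy A B (hw t) x σ)
      (fun σ τ => ((hl t).mul_const (Y σ τ)).exp)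
    refine h1.congr_deriv ?_
    simp only [hF', hP, hD, ← pairAvg_const_mul, ← pairAvg_sum, ← pairAvg_add]
    congr 1
    ext σ τ
    have e1 : ∑ ρ, softmax (disorderEnergy A B (w t) x) ρ * ∑ a, w' t a * x a * A a ρ =
        ∑ a, w' t a * x a * ∑ ρ, softmax (disorderEnergy A B (w t) x) ρ * A a ρ := by
      simp only [Finset.mul_sum]
      rw [Finset.sum_comm]
      exact Finset.sum_congr rfl fun _ _ => Finset.sum_congr rfl fun _ _ => by ring
    rw [e1]
    congr 1
    · ring
    · simp only [Finset.mul_sum (s := (univ : Finset I)), ← Finset.sum_add_distrib,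
        ← Finset.sum_sub_distrib]
      exact Finset.sum_congr rfl fun _ _ => by ring
  have hint : ∀ t, HasDerivAt (fun t => ∫ x, F t x ∂stdGauss I) (∫ x, F' t x ∂stdGauss I) t := by
    intro t
    refine (hasDerivAt_integral_of_dominated_loc_of_deriv_le (s := Set.univ)
      (bound := fun x => K * (C * Real.exp (K * C)) +
        ∑ a, K * (|x a| * (Real.exp (K * C) * 4))) Filter.univ_mem
      (.of_forall fun s => (cF s).aestronglyMeasurable) (iF t) ?_
      (.of_forall fun x s _ => ?_) ?_ (.of_forall fun x s _ => hder s x)).2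
    · refine Continuous.aestronglyMeasurable ?_
      have := cP t
      have := cD t
      fun_prop
    · rw [Real.norm_eq_abs]
      refine (abs_add_le _ _).trans (add_le_add ?_ ?_)
      · rw [abs_mul, abs_neg]
        exact mul_le_mul (hκK s) (bP s x) (abs_nonneg _) hK
      · refine (Finset.abs_sum_le_sum_abs _ _).trans (Finset.sum_le_sum fun a _ => ?_)
        rw [abs_mul, abs_mul]
        exact mul_le_mul (hw' s a) (mul_le_mul_of_nonneg_left (bD s a x) (abs_nonneg _))
          (by positivity) hK
    · exact (integrable_const _).add (integrable_finsetSum _ fun a _ =>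
        ((integrable_coord_stdGauss a).abs.mul_const _).const_mul _)
  have hle : ∀ t ∈ Set.Icc 0 T, ∫ x, F' t x ∂stdGauss I ≤ 0 := by
    intro t ht
    have h1 : ∫ x, F' t x ∂stdGauss I =
        ∫ x, (-(8 * κ t) * P t x + ∑ a, w' t a * w t a * E t a x) ∂stdGauss I := by
      simp only [hF']
      rw [integral_add ((iP t).const_mul _) (integrable_finsetSum _ fun a _ =>
          (ixD t a).const_mul _),
        integral_add ((iP t).const_mul _) (integrable_finsetSum _ fun a _ =>
          (iE t a).const_mul _),
        integral_finsetSum _ (fun a _ => (ixD t a).const_mul _),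
        integral_finsetSum _ (fun a _ => (iE t a).const_mul _)]
      congr 1
      refine Finset.sum_congr rfl fun a _ => ?_
      rw [integral_const_mul, integral_coord_mul_pairAvg A hA B (w t) _ a, integral_const_mul,
        integral_const_mul, mul_assoc]
    rw [h1]
    refine integral_nonpos fun x => ?_
    have := sum_pairAvg_second_order_le (disorderEnergy A B (w t) x) A
      (fun a => w' t a * w t a) Y hY (hκ t ht) (hl0 t) (hc t)
    simp only [Pi.zero_apply]
    linarith
  have hanti : AntitoneOn (fun t => ∫ x, F t x ∂stdGauss I) (Set.Icc 0 T) := by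
    refine antitoneOn_of_deriv_nonpos (convex_Icc 0 T)
      (fun t _ => (hint t).continuousAt.continuousWithinAt)
      (fun t _ => (hint t).differentiableAt.differentiableWithinAt) fun t ht => ?_
    rw [(hint t).deriv]
    exact hle t (interior_subset ht)
  exact hanti (Set.left_mem_Icc.2 hT) (Set.right_mem_Icc.2 hT) hT

end Interpolation

/-! ### Independent sites -/

lemma integral_exp_mul_gauss (t : ℝ) :
    ∫ x, Real.exp (t * x) ∂(gaussianReal 0 1) = Real.exp (t ^ 2 / 2) := by
  have := congrFun (mgf_fun_id_gaussianReal (μ := 0) (v := 1)) t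
  simpa [mgf] using this

lemma integrable_exp_mul_gauss (t : ℝ) :
    Integrable (fun x => Real.exp (t * x)) (gaussianReal 0 1) :=
  integrable_exp_mul_gaussianReal t

lemma integral_exp_sq_gauss_le :
    Integrable (fun x : ℝ => Real.exp (x ^ 2 / 4)) (gaussianReal 0 1) ∧
      ∫ x, Real.exp (x ^ 2 / 4) ∂(gaussianReal 0 1) ≤ 2 := by
  have hpt : ∀ x : ℝ, gaussianPDFReal 0 1 x * Real.exp (x ^ 2 / 4) =
      (Real.sqrt (2 * Real.pi))⁻¹ * Real.exp (-(1 / 4) * x ^ 2) := by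
    intro x
    rw [gaussianPDFReal]
    simp only [NNReal.coe_one, mul_one, sub_zero]
    rw [mul_assoc, ← Real.exp_add]
    congr 2
    ring
  constructor
  · rw [gaussianReal_of_var_ne_zero _ one_ne_zero,
      integrable_withDensity_iff_integrable_smul' (measurable_gaussianPDF 0 1)
        (by simp [gaussianPDF_lt_top])]
    simp only [toReal_gaussianPDF, smul_eq_mul, hpt]
    exact (integrable_exp_neg_mul_sq (by norm_num)).const_mul _
  · rw [integral_gaussianReal_eq_integral_smul one_ne_zero]
    simp only [smul_eq_mul, hpt]
    rw [integral_const_mul, integral_gaussian, ← Real.sqrt_inv,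
      ← Real.sqrt_mul (by positivity), Real.sqrt_le_left (by norm_num)]
    have := Real.pi_pos
    field_simp
    norm_num

lemma spin_sq (b : Bool) : spin b ^ 2 = 1 := by cases b <;> simp [spin]

/-- Sub-Gaussian bound for the product of two spins with mean `q`. -/
lemma sum_mul_exp_spin_le {c : Bool → Bool → ℝ} {q : ℝ} (h0 : ∀ a b, 0 ≤ c a b)
    (h1 : ∑ a, ∑ b, c a b = 1) (hq : ∑ a, ∑ b, c a b * (spin a * spin b) = q) (s : ℝ) :
    ∑ a, ∑ b, c a b * Real.exp (s * (spin a * spin b - q)) ≤ Real.exp (2 * s ^ 2) := by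
  simp only [Fintype.sum_bool, spin, if_true, Bool.false_eq_true, if_false] at *
  set P := c true true + c false false with hP
  have hP' : c true false + c false true = 1 - P := by rw [hP]; linarith
  have hq' : q = 2 * P - 1 := by rw [hP]; linarith
  have hP0 : 0 ≤ P := add_nonneg (h0 _ _) (h0 _ _)
  have hP1 : 0 ≤ 1 - P := hP' ▸ add_nonneg (h0 _ _) (h0 _ _)
  have e1 : Real.exp (s * (1 - q)) = Real.exp s * Real.exp (-(s * q)) := by
    rw [← Real.exp_add]; ring_nf
  have e2 : Real.exp (s * (-1 - q)) = Real.exp (-s) * Real.exp (-(s * q)) := by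
    rw [← Real.exp_add]; ring_nf
  have hconv : Real.exp (-(s * q)) ≤ P * Real.exp (-s) + (1 - P) * Real.exp s := by
    have := convexOn_exp.2 (Set.mem_univ (-s)) (Set.mem_univ s) hP0 hP1 (by ring)
    simp only [smul_eq_mul] at this
    rwa [show P * -s + (1 - P) * s = -(s * q) by rw [hq']; ring] at this
  have hcosh := Real.cosh_le_exp_half_sq (2 * s)
  rw [Real.cosh_eq] at hcosh
  have f1 : Real.exp (2 * s) = Real.exp s ^ 2 := by rw [← Real.exp_nat_mul]; norm_num
  have f2 : Real.exp (-(2 * s)) = Real.exp (-s) ^ 2 := by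
    rw [← Real.exp_nat_mul]; congr 1; push_cast; ring
  have f3 : Real.exp s * Real.exp (-s) = 1 := by rw [← Real.exp_add]; simp
  rw [f1, f2, show (2 * s) ^ 2 / 2 = 2 * s ^ 2 by ring] at hcosh
  refine le_trans ?_ hcosh
  calc _ = (P * Real.exp s + (1 - P) * Real.exp (-s)) * Real.exp (-(s * q)) := by
        simp only [mul_one, mul_neg, neg_neg]
        rw [e1, e2, ← hP', hP]; ring
    _ ≤ (P * Real.exp s + (1 - P) * Real.exp (-s)) *
        (P * Real.exp (-s) + (1 - P) * Real.exp s) :=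
        mul_le_mul_of_nonneg_left hconv (by positivity)
    _ = (P ^ 2 + (1 - P) ^ 2) * (Real.exp s * Real.exp (-s)) +
        P * (1 - P) * (Real.exp s ^ 2 + Real.exp (-s) ^ 2) := by ring
    _ ≤ _ := by
        rw [f3]
        nlinarith [mul_nonneg (sq_nonneg (2 * P - 1)) (sq_nonneg (Real.exp s - Real.exp (-s)))]

lemma sum_sum_prod_eq_pow {N : ℕ} (G : Bool → Bool → ℝ) :
    ∑ σ : Cfg N, ∑ τ : Cfg N, ∏ i, G (σ i) (τ i) = (∑ a, ∑ b, G a b) ^ N := by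
  have h : ∀ F : Fin N → Bool → ℝ, ∑ σ : Cfg N, ∏ i, F i (σ i) = ∏ i, ∑ a, F i a := fun F => by
    rw [Finset.prod_univ_sum, Fintype.piFinset_univ]
  simp_rw [h, h fun _ a => ∑ b, G a b]
  simp

/-- Exponential moments of the squared overlap fluctuation for independent pairs of spins. -/
lemma sum_prod_mul_exp_overlap_le {N : ℕ} (hN : 0 < N) {c : Bool → Bool → ℝ} {q : ℝ}
    (h0 : ∀ a b, 0 ≤ c a b) (h1 : ∑ a, ∑ b, c a b = 1)
    (hq : ∑ a, ∑ b, c a b * (spin a * spin b) = q) :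
    ∑ σ : Cfg N, ∑ τ : Cfg N, (∏ i, c (σ i) (τ i)) *
      Real.exp (1 / 16 * (N * (overlap N σ τ - q) ^ 2)) ≤ 2 := by
  have hN' : (0 : ℝ) < N := by exact_mod_cast hN
  set r := Real.sqrt (8 * N) with hr
  have hr0 : 0 < r := Real.sqrt_pos.2 (by positivity)
  have hr2 : r ^ 2 = 8 * N := Real.sq_sqrt (by positivity)
  have hsum : ∀ σ τ : Cfg N, N * (overlap N σ τ - q) = ∑ i, (spin (σ i) * spin (τ i) - q) := by
    intro σ τ
    rw [overlap, Finset.sum_sub_distrib]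
    simp
    field_simp
  have hexp : ∀ σ τ : Cfg N, Real.exp (1 / 16 * (N * (overlap N σ τ - q) ^ 2)) =
      ∫ x, Real.exp ((∑ i, (spin (σ i) * spin (τ i) - q)) / r * x) ∂(gaussianReal 0 1) := by
    intro σ τ
    rw [integral_exp_mul_gauss, ← hsum, div_pow, hr2]
    congr 1
    field_simp
    ring
  have hprod : ∀ (σ τ : Cfg N) (x : ℝ),
      (∏ i, c (σ i) (τ i)) * Real.exp ((∑ i, (spin (σ i) * spin (τ i) - q)) / r * x) =
      ∏ i, c (σ i) (τ i) * Real.exp (x / r * (spin (σ i) * spin (τ i) - q)) := by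
    intro σ τ x
    rw [Finset.prod_mul_distrib, ← Real.exp_sum, ← Finset.mul_sum]
    congr 2
    ring
  have hint : ∀ σ τ : Cfg N, Integrable (fun x => (∏ i, c (σ i) (τ i)) *
      Real.exp ((∑ i, (spin (σ i) * spin (τ i) - q)) / r * x)) (gaussianReal 0 1) :=
    fun σ τ => (integrable_exp_mul_gauss _).const_mul _
  simp_rw [hexp, ← integral_const_mul]
  simp_rw [← integral_finsetSum univ fun τ _ => hint _ τ]
  rw [← integral_finsetSum univ fun σ _ => integrable_finsetSum _ fun τ _ => hint σ τ]
  refine le_trans (integral_mono (integrable_finsetSum _ fun σ _ =>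
    integrable_finsetSum _ fun τ _ => hint σ τ) integral_exp_sq_gauss_le.1 fun x => ?_)
    integral_exp_sq_gauss_le.2
  simp only [hprod]
  rw [sum_sum_prod_eq_pow fun a b => c a b * Real.exp (x / r * (spin a * spin b - q))]
  refine (pow_le_pow_left₀ (Finset.sum_nonneg fun a _ => Finset.sum_nonneg fun b _ =>
    mul_nonneg (h0 a b) (Real.exp_pos _).le) (sum_mul_exp_spin_le h0 h1 hq (x / r)) N).trans ?_
  rw [← Real.exp_nat_mul, div_pow, hr2]
  refine le_of_eq (congrArg _ ?_)
  field_simp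
  ring

/-! ### The interpolation for the Sherrington-Kirkpatrick model -/

/-- The interactions: products of two spins off the diagonal, single spins on the diagonal. -/
def skInteraction (N : ℕ) (p : Fin N × Fin N) (σ : Cfg N) : ℝ :=
  if p.1 = p.2 then spin (σ p.1) else spin (σ p.1) * spin (σ p.2)

/-- The external field. -/
def skField (N : ℕ) (h : ℝ) (σ : Cfg N) : ℝ := h * ∑ i, spin (σ i)

/-- Weights with coupling part `a` and single-site part `b`. -/
def skWeight (N : ℕ) (a b : ℝ) (p : Fin N × Fin N) : ℝ :=
  if p.1 < p.2 then a else if p.1 = p.2 then b else 0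

lemma skInteraction_sq (N : ℕ) (p : Fin N × Fin N) (σ : Cfg N) : skInteraction N p σ ^ 2 = 1 := by
  unfold skInteraction
  split_ifs
  · exact spin_sq _
  · rw [mul_pow, spin_sq, spin_sq, one_mul]

lemma measurePreserving_uncurry_gaussN (N : ℕ) :
    MeasurePreserving (fun (g : Fin N → Fin N → ℝ) (p : Fin N × Fin N) => g p.1 p.2)
      (gaussN N) (stdGauss (Fin N × Fin N)) := by
  have hm : Measurable fun (g : Fin N → Fin N → ℝ) (p : Fin N × Fin N) => g p.1 p.2 := by
    fun_prop
  refine ⟨hm, ?_⟩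
  symm
  refine Measure.pi_eq fun s hs => ?_
  rw [Measure.map_apply hm (.univ_pi hs)]
  have : (fun (g : Fin N → Fin N → ℝ) (p : Fin N × Fin N) => g p.1 p.2) ⁻¹' Set.univ.pi s =
      Set.univ.pi fun i => Set.univ.pi fun j => s (i, j) := by
    ext g
    simp [Set.mem_pi]
  rw [this, gaussN, Measure.pi_pi]
  simp_rw [Measure.pi_pi]
  rw [Fintype.prod_prod_type]

lemma sum_skWeight_mul {N : ℕ} (a b : ℝ) (f : Fin N × Fin N → ℝ) :
    ∑ p, skWeight N a b p * f p =
      a * (∑ i, ∑ j, if i < j then f (i, j) else 0) + b * ∑ i, f (i, i) := by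
  have h : ∀ i j : Fin N, skWeight N a b (i, j) * f (i, j) =
      a * (if i < j then f (i, j) else 0) + b * (if i = j then f (i, j) else 0) := by
    intro i j
    simp only [skWeight]
    split_ifs with h1 h2
    · exact absurd h2 h1.ne
    all_goals simp
  rw [Fintype.sum_prod_type]
  simp_rw [h, Finset.sum_add_distrib, ← Finset.mul_sum]
  simp

lemma disorderEnergy_sk_eq_negH (N : ℕ) (β h : ℝ) (g : Fin N → Fin N → ℝ) (σ : Cfg N) :
    disorderEnergy (skInteraction N) (skField N h) (skWeight N (β / Real.sqrt N) 0)
      (fun p => g p.1 p.2) σ = negH N β h g σ := by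
  simp only [disorderEnergy, negH, skField, mul_assoc]
  rw [sum_skWeight_mul, zero_mul, add_zero]
  congr 2
  refine Finset.sum_congr rfl fun i _ => Finset.sum_congr rfl fun j _ => ?_
  split_ifs with hij
  · simp [skInteraction, hij.ne]
  · rfl

/-- Two-replica Gibbs averages as averages over the Gaussian vector. -/
lemma nu_eq_integral_pairAvg (N : ℕ) (β h : ℝ) (F : Cfg N → Cfg N → ℝ) :
    nu N β h (fun σs : Fin 2 → Cfg N => F (σs 0) (σs 1)) =
      ∫ x, pairAvg (disorderEnergy (skInteraction N) (skField N h)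
        (skWeight N (β / Real.sqrt N) 0) x) F ∂stdGauss (Fin N × Fin N) := by
  have hc : Continuous fun x => pairAvg (disorderEnergy (skInteraction N) (skField N h)
      (skWeight N (β / Real.sqrt N) 0) x) F :=
    continuous_pairAvg (continuous_disorderEnergy _ _ _) fun _ _ => continuous_const
  rw [nu, ← (measurePreserving_uncurry_gaussN N).map_eq,
    integral_map (measurePreserving_uncurry_gaussN N).aemeasurable hc.aestronglyMeasurable]
  congr 1
  ext g
  have hE : disorderEnergy (skInteraction N) (skField N h) (skWeight N (β / Real.sqrt N) 0)
      (fun p => g p.1 p.2) = negH N β h g := funext (disorderEnergy_sk_eq_negH N β h g)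
  rw [hE, gibbs, ← (finTwoArrowEquiv (Cfg N)).symm.sum_comp, Fintype.sum_prod_type, pairAvg,
    Finset.sum_div]
  refine Finset.sum_congr rfl fun σ _ => ?_
  rw [Finset.sum_div]
  refine Finset.sum_congr rfl fun τ _ => ?_
  simp [softmax, Fin.prod_univ_two]
  ring

lemma two_mul_sum_lt {N : ℕ} (s : Fin N → ℝ) (hs : ∀ i, s i ^ 2 = 1) :
    2 * ∑ i, ∑ j, (if i < j then s i * s j else 0) = (∑ i, s i) ^ 2 - N := by
  have h1 : (∑ i, s i) ^ 2 = ∑ i, ∑ j, ((if i < j then s i * s j else 0) +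
      (if j < i then s j * s i else 0) + if i = j then 1 else 0) := by
    rw [sq, Finset.sum_mul_sum]
    refine Finset.sum_congr rfl fun i _ => Finset.sum_congr rfl fun j _ => ?_
    rcases lt_trichotomy i j with h | h | h
    · simp [h, h.not_gt, h.ne]
    · subst h; simp [← sq, hs]
    · simp [h, h.not_gt, h.ne', mul_comm]
  rw [h1]
  simp_rw [Finset.sum_add_distrib]
  rw [Finset.sum_comm (f := fun i j => if j < i then s j * s i else 0)]
  simp
  ring

lemma sum_skWeight_covariance {N : ℕ} (hN : 0 < N) (a q : ℝ) (σ τ : Cfg N) :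
    ∑ p, skWeight N (a / N) (-(a * q)) p * (skInteraction N p σ * skInteraction N p τ) =
      a / 2 * (N * (overlap N σ τ - q) ^ 2) + -(a * (N * q ^ 2 + 1) / 2) := by
  have hN' : (N : ℝ) ≠ 0 := by exact_mod_cast hN.ne'
  have h := two_mul_sum_lt (fun i => spin (σ i) * spin (τ i)) fun i => by
    rw [mul_pow, spin_sq, spin_sq, one_mul]
  have h2 : ∑ i, ∑ j, (if i < j then skInteraction N (i, j) σ * skInteraction N (i, j) τ else 0) =
      ∑ i, ∑ j, (if i < j then (spin (σ i) * spin (τ i)) * (spin (σ j) * spin (τ j)) else 0) := by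
    refine Finset.sum_congr rfl fun i _ => Finset.sum_congr rfl fun j _ => ?_
    split_ifs with hij
    · simp only [skInteraction, hij.ne, if_false]; ring
    · rfl
  have h3 : ∑ i, skInteraction N (i, i) σ * skInteraction N (i, i) τ = N * overlap N σ τ := by
    simp only [skInteraction, if_true, overlap]
    field_simp
  have h4 : ∑ i, spin (σ i) * spin (τ i) = N * overlap N σ τ := by
    rw [overlap]; field_simp
  rw [sum_skWeight_mul, h2, h3]
  rw [h4] at h
  generalize ∑ i, ∑ j, (if i < j then (spin (σ i) * spin (τ i)) * (spin (σ j) * spin (τ j)) else 0)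
    = X at h ⊢
  rw [show X = ((N * overlap N σ τ) ^ 2 - N) / 2 by linarith]
  field_simp
  ring

/-- The single-site Gibbs weight in the field `y`. -/
def siteWeight (y : ℝ) (b : Bool) : ℝ := Real.exp (y * spin b) / (Real.exp y + Real.exp (-y))

lemma siteWeight_nonneg (y : ℝ) (b : Bool) : 0 ≤ siteWeight y b := by
  unfold siteWeight; positivity

lemma sum_siteWeight (y : ℝ) : ∑ b, siteWeight y b = 1 := by
  simp only [siteWeight, Fintype.sum_bool, spin, if_true, Bool.false_eq_true, if_false, mul_one,
    mul_neg, ← add_div]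
  exact div_self (by positivity)

lemma sum_siteWeight_mul_spin (y : ℝ) : ∑ b, siteWeight y b * spin b = Real.tanh y := by
  simp only [siteWeight, Fintype.sum_bool, spin, if_true, Bool.false_eq_true, if_false, mul_one,
    mul_neg, Real.tanh_eq]
  ring

lemma continuous_siteWeight (b : Bool) : Continuous fun y => siteWeight y b := by
  unfold siteWeight
  exact Continuous.div (by fun_prop) (by fun_prop) fun y => by positivity

lemma siteWeight_le_one (y : ℝ) (b : Bool) : siteWeight y b ≤ 1 := by
  rw [← sum_siteWeight y]
  exact Finset.single_le_sum (fun b _ => siteWeight_nonneg y b) (mem_univ b)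

lemma softmax_sum_mul_spin {N : ℕ} (y : Fin N → ℝ) (σ : Cfg N) :
    softmax (fun σ : Cfg N => ∑ i, y i * spin (σ i)) σ = ∏ i, siteWeight (y i) (σ i) := by
  simp only [softmax, siteWeight, Real.exp_sum, Finset.prod_div_distrib]
  congr 1
  have := Finset.prod_univ_sum (fun _ : Fin N => (univ : Finset Bool))
    fun i b => Real.exp (y i * spin b)
  rw [Fintype.piFinset_univ] at this
  rw [← this]
  refine Finset.prod_congr rfl fun i _ => ?_
  simp [spin]

lemma integral_prod_diag {N : ℕ} (f : Fin N → ℝ → ℝ) :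
    ∫ x, ∏ i, f i (x (i, i)) ∂stdGauss (Fin N × Fin N) =
      ∏ i, ∫ z, f i z ∂(gaussianReal 0 1) := by
  have h := integral_fintype_prod_eq_prod (μ := fun _ : Fin N × Fin N => gaussianReal 0 1)
    (fun (p : Fin N × Fin N) z => if p.1 = p.2 then f p.1 z else (1 : ℝ))
  rw [stdGauss]
  simp only [Fintype.prod_prod_type] at h
  convert h using 1
  · congr 1
    ext x
    refine Finset.prod_congr rfl fun i _ => ?_
    rw [Finset.prod_ite_eq]; simp
  · refine Finset.prod_congr rfl fun i _ => ?_
    rw [Finset.prod_eq_single i]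
    · simp
    · intro j _ hj
      simp [hj.symm]
    · simp

/-- The exponential moment at the decoupled end of the interpolation. -/
lemma integral_pairAvg_decoupled_le {N : ℕ} (hN : 0 < N) (β h q : ℝ)
    (hq : q = ∫ z, Real.tanh (β * z * Real.sqrt q + h) ^ 2 ∂(gaussianReal 0 1)) :
    ∫ x, pairAvg (disorderEnergy (skInteraction N) (skField N h)
        (skWeight N 0 (β * Real.sqrt q)) x)
      (fun σ τ => Real.exp (1 / 16 * (N * (overlap N σ τ - q) ^ 2)))
        ∂stdGauss (Fin N × Fin N) ≤ 2 := by
  set c : Bool → Bool → ℝ := fun a b => ∫ z, siteWeight (β * z * Real.sqrt q + h) a *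
    siteWeight (β * z * Real.sqrt q + h) b ∂(gaussianReal 0 1) with hc
  have hci : ∀ a b, Integrable (fun z => siteWeight (β * z * Real.sqrt q + h) a *
      siteWeight (β * z * Real.sqrt q + h) b) (gaussianReal 0 1) := by
    intro a b
    refine .of_bound (C := 1) (Continuous.aestronglyMeasurable ?_) (.of_forall fun z => ?_)
    · exact ((continuous_siteWeight a).comp (by fun_prop)).mul
        ((continuous_siteWeight b).comp (by fun_prop))
    · rw [Real.norm_eq_abs, abs_of_nonneg (mul_nonneg (siteWeight_nonneg _ _)
        (siteWeight_nonneg _ _))]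
      exact mul_le_one₀ (siteWeight_le_one _ _) (siteWeight_nonneg _ _) (siteWeight_le_one _ _)
  have h0 : ∀ a b, 0 ≤ c a b := fun a b =>
    integral_nonneg fun z => mul_nonneg (siteWeight_nonneg _ _) (siteWeight_nonneg _ _)
  have h1 : ∑ a, ∑ b, c a b = 1 := by
    simp only [hc]
    simp_rw [← integral_finsetSum univ fun b _ => hci _ b]
    rw [← integral_finsetSum univ fun a _ => integrable_finsetSum _ fun b _ => hci a b]
    simp_rw [← Finset.mul_sum, sum_siteWeight, mul_one, sum_siteWeight]
    simp
  have h2 : ∑ a, ∑ b, c a b * (spin a * spin b) = q := by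
    simp only [hc, ← integral_mul_const]
    simp_rw [← integral_finsetSum univ fun b _ => (hci _ b).mul_const _]
    rw [← integral_finsetSum univ fun a _ => integrable_finsetSum _ fun b _ =>
      (hci a b).mul_const _]
    conv_rhs => rw [hq]
    congr 1
    ext z
    rw [← sum_siteWeight_mul_spin, sq, Finset.sum_mul_sum]
    exact Finset.sum_congr rfl fun _ _ => Finset.sum_congr rfl fun _ _ => by ring
  have hE : ∀ x : Fin N × Fin N → ℝ, disorderEnergy (skInteraction N) (skField N h)
      (skWeight N 0 (β * Real.sqrt q)) x =
      fun σ => ∑ i, (β * x (i, i) * Real.sqrt q + h) * spin (σ i) := by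
    intro x
    ext σ
    simp only [disorderEnergy, skField, mul_assoc]
    rw [sum_skWeight_mul, zero_mul, zero_add, Finset.mul_sum, Finset.mul_sum,
      ← Finset.sum_add_distrib]
    refine Finset.sum_congr rfl fun i _ => ?_
    simp only [skInteraction, if_true]
    ring
  have hint : ∀ σ τ : Cfg N, Integrable (fun x : Fin N × Fin N → ℝ =>
      (∏ i, siteWeight (β * x (i, i) * Real.sqrt q + h) (σ i) *
        siteWeight (β * x (i, i) * Real.sqrt q + h) (τ i)) *
      Real.exp (1 / 16 * (N * (overlap N σ τ - q) ^ 2))) (stdGauss (Fin N × Fin N)) := by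
    intro σ τ
    refine Integrable.mul_const ?_ _
    refine .of_bound (C := 1) (Continuous.aestronglyMeasurable ?_) (.of_forall fun z => ?_)
    · exact continuous_finsetProd _ fun i _ =>
        ((continuous_siteWeight _).comp (by fun_prop)).mul
          ((continuous_siteWeight _).comp (by fun_prop))
    · rw [Real.norm_eq_abs, abs_of_nonneg (Finset.prod_nonneg fun i _ =>
        mul_nonneg (siteWeight_nonneg _ _) (siteWeight_nonneg _ _))]
      exact Finset.prod_le_one (fun i _ => mul_nonneg (siteWeight_nonneg _ _)
        (siteWeight_nonneg _ _)) fun i _ =>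
        mul_le_one₀ (siteWeight_le_one _ _) (siteWeight_nonneg _ _) (siteWeight_le_one _ _)
  refine le_trans (le_of_eq ?_) (sum_prod_mul_exp_overlap_le hN h0 h1 h2)
  simp only [pairAvg, hE, softmax_sum_mul_spin, ← Finset.prod_mul_distrib]
  rw [integral_finsetSum univ fun σ _ => integrable_finsetSum _ fun τ _ => hint σ τ]
  refine Finset.sum_congr rfl fun σ _ => ?_
  rw [integral_finsetSum univ fun τ _ => hint σ τ]
  refine Finset.sum_congr rfl fun τ _ => ?_
  rw [integral_mul_const, integral_prod_diag fun i z => siteWeight (β * z * Real.sqrt q + h) (σ i) *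
    siteWeight (β * z * Real.sqrt q + h) (τ i)]

/-- At high temperature the squared overlap fluctuation has a bounded exponential moment. -/
theorem integral_pairAvg_exp_overlap_le {N : ℕ} (hN : 0 < N) {β h q : ℝ} (hβ : 0 < β)
    (hβ' : β < 1 / 8) (hq1 : q < 1) (hq0 : 0 ≤ q)
    (hq : q = ∫ z, Real.tanh (β * z * Real.sqrt q + h) ^ 2 ∂(gaussianReal 0 1)) :
    ∫ x, pairAvg (disorderEnergy (skInteraction N) (skField N h)
        (skWeight N (β / Real.sqrt N) 0) x)
      (fun σ τ => Real.exp (1 / 32 * (N * (overlap N σ τ - q) ^ 2)))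
        ∂stdGauss (Fin N × Fin N) ≤ 2 := by
  have hN' : (1 : ℝ) ≤ N := by exact_mod_cast hN
  have hsN : 1 ≤ Real.sqrt N := Real.one_le_sqrt.2 hN'
  have hsN2 : Real.sqrt N ^ 2 = N := Real.sq_sqrt (by positivity)
  have hsq : Real.sqrt q ^ 2 = q := Real.sq_sqrt hq0
  have hsq1 : Real.sqrt q ≤ 1 := Real.sqrt_le_one.2 hq1.le
  have hβ2 : β ^ 2 ≤ 1 / 64 := by nlinarith
  have hY : ∀ σ τ : Cfg N, 0 ≤ N * (overlap N σ τ - q) ^ 2 := fun σ τ => by positivity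
  have key := integral_pairAvg_exp_antitone (skInteraction N) (skInteraction_sq N) (skField N h)
    (fun σ τ => N * (overlap N σ τ - q) ^ 2) hY
    (w := fun t => skWeight N (β / Real.sqrt N * Real.sin t) (β * Real.sqrt q * Real.cos t))
    (w' := fun t => skWeight N (β / Real.sqrt N * Real.cos t) (-(β * Real.sqrt q * Real.sin t)))
    (l := fun t => 1 / 16 - 2 * β ^ 2 * Real.sin t ^ 2)
    (κ := fun t => β ^ 2 * (Real.sin t * Real.cos t) / 2)
    (d := fun t => -(β ^ 2 * (Real.sin t * Real.cos t) * (N * q ^ 2 + 1) / 2))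
    (K := 1) (T := Real.pi / 2) (by positivity) ?_ ?_ ?_ ?_ ?_ ?_ ?_ ?_
  · simp only [Real.sin_pi_div_two, Real.cos_pi_div_two, Real.sin_zero, Real.cos_zero, mul_zero,
      mul_one, one_pow, zero_pow two_ne_zero, sub_zero] at key
    refine le_trans (integral_mono ?_ ?_ fun x => pairAvg_mono fun σ τ => ?_)
      (key.trans (integral_pairAvg_decoupled_le hN β h q hq))
    · exact integrable_pairAvg _ _ _ _
    · exact integrable_pairAvg _ _ _ _
    · refine Real.exp_le_exp.2 (mul_le_mul_of_nonneg_right ?_ (hY σ τ))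
      linarith
  · intro t p
    simp only [skWeight]
    split_ifs
    · exact (Real.hasDerivAt_sin t).const_mul _
    · simpa using (Real.hasDerivAt_cos t).const_mul (β * Real.sqrt q)
    · exact hasDerivAt_const _ _
  · intro t p
    have hs := Real.abs_sin_le_one t
    have hc := Real.abs_cos_le_one t
    simp only [skWeight]
    split_ifs
    · rw [abs_mul]
      refine mul_le_one₀ ?_ (abs_nonneg _) hc
      rw [abs_of_nonneg (by positivity)]
      exact (div_le_one (by positivity)).2 (by linarith)
    · rw [abs_neg, abs_mul]
      refine mul_le_one₀ ?_ (abs_nonneg _) hs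
      rw [abs_of_nonneg (by positivity)]
      exact mul_le_one₀ (by linarith) (Real.sqrt_nonneg _) hsq1
    · simp
  · intro t
    refine ((((Real.hasDerivAt_sin t).pow 2).const_mul (2 * β ^ 2)).const_sub (1 / 16)).congr_deriv
      ?_
    simp
    ring
  · intro t
    nlinarith [Real.sin_sq_le_one t, sq_nonneg (Real.sin t), sq_nonneg β]
  · intro t
    nlinarith [mul_nonneg (sq_nonneg β) (sq_nonneg (Real.sin t))]
  · intro t ht
    have h1 := Real.sin_nonneg_of_nonneg_of_le_pi ht.1 (by linarith [ht.2, Real.pi_pos])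
    have h2 := Real.cos_nonneg_of_neg_pi_div_two_le_of_le (by linarith [ht.1, Real.pi_pos]) ht.2
    positivity
  · intro t
    have h1 : |Real.sin t * Real.cos t| ≤ 1 := by
      rw [abs_mul]
      exact mul_le_one₀ (Real.abs_sin_le_one t) (abs_nonneg _) (Real.abs_cos_le_one t)
    rw [abs_le] at h1 ⊢
    constructor <;> nlinarith [sq_nonneg β]
  · intro t σ τ
    rw [← sum_skWeight_covariance hN]
    refine Finset.sum_congr rfl fun p _ => ?_
    congr 1
    simp only [skWeight]
    split_ifs
    · rw [show β / Real.sqrt N * Real.cos t * (β / Real.sqrt N * Real.sin t) =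
        β ^ 2 * (Real.sin t * Real.cos t) / Real.sqrt N ^ 2 by ring, hsN2]
    · linear_combination (-(β ^ 2 * Real.sin t * Real.cos t)) * hsq
    · ring

/-- Even moments of the overlap fluctuation are bounded by its exponential moment. -/
lemma overlap_sub_pow_le {N : ℕ} (hN : 0 < N) (q : ℝ) (k : ℕ) (σ τ : Cfg N) :
    (overlap N σ τ - q) ^ (2 * k) ≤ (32 * k / N) ^ k *
      Real.exp (1 / 32 * (N * (overlap N σ τ - q) ^ 2)) := by
  have hN' : (0 : ℝ) < N := by exact_mod_cast hN
  have h1 := Real.pow_div_factorial_le_exp (x := 1 / 32 * (N * (overlap N σ τ - q) ^ 2))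
    (by positivity) k
  have h2 : (k.factorial : ℝ) ≤ (k : ℝ) ^ k := by exact_mod_cast Nat.factorial_le_pow k
  rw [div_le_iff₀ (by positivity)] at h1
  have h3 : (overlap N σ τ - q) ^ (2 * k) =
      (32 / N) ^ k * (1 / 32 * (N * (overlap N σ τ - q) ^ 2)) ^ k := by
    rw [← mul_pow, pow_mul]
    congr 1
    field_simp
  rw [h3, show (32 * (k : ℝ) / N) ^ k = (32 / N) ^ k * (k : ℝ) ^ k by rw [← mul_pow]; ring,
    mul_assoc]
  refine mul_le_mul_of_nonneg_left (h1.trans ?_) (by positivity)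
  rw [mul_comm]
  exact mul_le_mul_of_nonneg_right h2 (Real.exp_pos _).le

lemma overlapMinus_sub_pow_le (M : ℕ) (q : ℝ) (k : ℕ) (σ τ : Cfg (M + 1)) :
    (overlapMinus M σ τ - q) ^ (2 * k) ≤
      4 ^ k * ((overlap (M + 1) σ τ - q) ^ (2 * k) + (1 / (M + 1)) ^ (2 * k)) := by
  set x := overlap (M + 1) σ τ - q with hx
  set y := spin (σ (Fin.last M)) * spin (τ (Fin.last M)) / (M + 1) with hy
  have h1 : overlapMinus M σ τ - q = x - y := by
    rw [hx, hy, overlap, overlapMinus, Fin.sum_univ_castSucc]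
    push_cast
    ring
  have h2 : y ^ 2 = (1 / (M + 1)) ^ 2 := by
    rw [hy, div_pow, mul_pow, spin_sq, spin_sq, div_pow]; norm_num
  have h3 : (x - y) ^ 2 ≤ 4 * max (x ^ 2) (y ^ 2) := by
    nlinarith [le_max_left (x ^ 2) (y ^ 2), le_max_right (x ^ 2) (y ^ 2), sq_nonneg (x + y)]
  rw [h1, pow_mul, pow_mul, pow_mul, ← h2]
  refine (pow_le_pow_left₀ (sq_nonneg _) h3 k).trans ?_
  rw [mul_pow]
  refine mul_le_mul_of_nonneg_left ?_ (by positivity)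
  rcases max_choice (x ^ 2) (y ^ 2) with h | h <;> rw [h]
  · exact le_add_of_nonneg_right (by positivity)
  · exact le_add_of_nonneg_left (by positivity)

/-- Lemma 2, Theorem 2.5.1 and Lemma 2.5.2 of Talagrand: moment bounds
`ν((R_{1,2}-q)^{2k}) ≤ (Lk/N)^k` and `ν((R⁻_{1,2}-q)^{2k}) ≤ (Lk/N)^k` at high temperature. -/
theorem stmt5 :
    ∃ β₀ L : ℝ, 0 < β₀ ∧ 0 < L ∧
      ∀ β : ℝ, 0 < β → β < β₀ → ∀ h : ℝ, 0 ≤ h → ∀ M : ℕ, ∀ q : ℝ,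
        0 ≤ q → q < 1 →
        q = ∫ z, Real.tanh (β * z * Real.sqrt q + h) ^ 2 ∂ (gaussianReal 0 1 : Measure ℝ) →
        ∀ k : ℕ, 1 ≤ k →
          nu (M + 1) β h
              (fun σs : Fin 2 → Cfg (M + 1) =>
                (overlap (M + 1) (σs 0) (σs 1) - q) ^ (2 * k)) ≤ (L * k / (M + 1)) ^ k ∧
          nu (M + 1) β h
              (fun σs : Fin 2 → Cfg (M + 1) =>
                (overlapMinus M (σs 0) (σs 1) - q) ^ (2 * k)) ≤ (L * k / (M + 1)) ^ k := by
  refine ⟨1 / 8, 384, by norm_num, by norm_num, ?_⟩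
  intro β hβ hβ' h _ M q hq0 hq1 hq k hk
  have hk' : (1 : ℝ) ≤ k := by exact_mod_cast hk
  have hM : (1 : ℝ) ≤ M + 1 := by
    have := Nat.cast_nonneg (α := ℝ) M
    linarith
  have hN : 0 < M + 1 := M.succ_pos
  have hexp := integral_pairAvg_exp_overlap_le hN hβ hβ' hq1 hq0 hq
  set u := fun x => disorderEnergy (skInteraction (M + 1)) (skField (M + 1) h)
    (skWeight (M + 1) (β / Real.sqrt ((M + 1 : ℕ) : ℝ)) 0) x with hu
  have hint : ∀ F : Cfg (M + 1) → Cfg (M + 1) → ℝ, Integrable (fun x => pairAvg (u x) F)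
      (stdGauss (Fin (M + 1) × Fin (M + 1))) := fun F => integrable_pairAvg _ _ _ F
  have hbase : ∫ x, pairAvg (u x) (fun σ τ => (overlap (M + 1) σ τ - q) ^ (2 * k))
      ∂stdGauss (Fin (M + 1) × Fin (M + 1)) ≤ 2 * (32 * k / (M + 1)) ^ k := by
    refine (integral_mono (hint _) ((hint _).const_mul _) fun x =>
      (pairAvg_mono fun σ τ => overlap_sub_pow_le hN q k σ τ).trans
        (pairAvg_const_mul _ _ _).le).trans ?_
    rw [integral_const_mul, mul_comm, ← Nat.cast_succ M]
    exact mul_le_mul_of_nonneg_right hexp (by positivity)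
  have hpos : (0 : ℝ) ≤ (32 * k / (M + 1)) ^ k := by positivity
  have hL : (384 * k / (M + 1) : ℝ) ^ k = 4 ^ k * 3 ^ k * (32 * k / (M + 1)) ^ k := by
    rw [← mul_pow, ← mul_pow]; ring
  have h3 : (3 : ℝ) ≤ 3 ^ k := le_self_pow₀ (by norm_num) (by omega)
  have h4 : (1 : ℝ) ≤ 4 ^ k := one_le_pow₀ (by norm_num)
  rw [hL]
  constructor
  · rw [nu_eq_integral_pairAvg (M + 1) β h fun σ τ => (overlap (M + 1) σ τ - q) ^ (2 * k)]
    refine hbase.trans (mul_le_mul_of_nonneg_right ?_ hpos)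
    nlinarith
  · rw [nu_eq_integral_pairAvg (M + 1) β h fun σ τ => (overlapMinus M σ τ - q) ^ (2 * k)]
    refine (integral_mono (hint _) (((hint _).add (hint fun _ _ => _)).const_mul _) fun x =>
      (pairAvg_mono fun σ τ => overlapMinus_sub_pow_le M q k σ τ).trans
        (((pairAvg_const_mul _ _ _).trans (congrArg _ (pairAvg_add _ _ _))).le)).trans ?_
    simp only [Pi.add_apply]
    rw [integral_const_mul, integral_add (hint _) (hint _), mul_assoc]
    refine mul_le_mul_of_nonneg_left ?_ (by positivity)
    simp only [pairAvg_const]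
    rw [integral_const, probReal_univ, one_smul, pow_mul]
    have hle : ((1 / (M + 1) : ℝ) ^ 2) ^ k ≤ (32 * k / (M + 1)) ^ k := by
      refine pow_le_pow_left₀ (by positivity) ?_ k
      rw [div_pow, one_pow, div_le_div_iff₀ (by positivity) (by positivity)]
      nlinarith [mul_nonneg (sub_nonneg.2 hk') (sq_nonneg ((M : ℝ) + 1))]
    refine (add_le_add hbase hle).trans ?_
    nlinarith

end
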